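/- (Inductive fraction series.) Let k=(k_1,…,k_r) be a nonempty index and write k_− = (k_1,…,k_{r−1}) (the empty index if r=1). Then for all z∈ℂ with Re(z)>−1, F_k(z) = Σ_{n=1}^{∞} ( s⋆(k,n) − F_{k_−}(n+z)/(n+z)^{k_r} ), where F_∅(z)=1. -/

import Mathlib

open MeasureTheory Filter Topology

namespace Kawashima

/-- The set `A(k) = {k₁, k₁+k₂, …, k₁+⋯+k_{r-1}}` of proper nonempty partial sums
of an index `k = (k₁, …, k_r)`. -/
def Aset (k : List ℕ) : Finset ℕ :=
  (Finset.Ico 1 k.length).image (fun i => (k.take i).sum)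

/-- The Hoffman dual of an index `k`: the unique index `k∨` with the same weight such
that `A(k)` and `A(k∨)` partition `{1, …, wt(k) - 1}`.  It is computed here as the
composition of `wt(k)` whose partial-sum set is the complement of `A(k)`. -/
def hdual (k : List ℕ) : List ℕ :=
  let w := k.sum
  let L := (insert w ((Finset.Icc 1 (w - 1)) \ Aset k)).sort (· ≤ ·)
  L.zipWith (fun a b => a - b) (0 :: L)

/-- `sStar k N = s⋆(k, N) = Σ_{0 < m₁ ≤ ⋯ ≤ m_{r-1} ≤ m_r = N} 1/(m₁^{k₁} ⋯ m_r^{k_r})`.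
For the empty index the value is `1` (empty product), and for a nonempty index and
`N = 0` the value is `0` (empty sum). -/
noncomputable def sStar (k : List ℕ) (N : ℕ) : ℝ :=
  ∑ m : Fin k.length → Fin (N + 1),
    if (∀ i, 0 < (m i : ℕ)) ∧
       (∀ i j : Fin k.length, i ≤ j → (m i : ℕ) ≤ (m j : ℕ)) ∧
       (∀ i : Fin k.length, (i : ℕ) + 1 = k.length → (m i : ℕ) = N)
    then ∏ i : Fin k.length, 1 / ((m i : ℕ) : ℝ) ^ k.get i
    else 0

/-- `SStar k N = S⋆(k, N) = Σ_{n=1}^N s⋆(k, n)`. -/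
noncomputable def SStar (k : List ℕ) (N : ℕ) : ℝ :=
  ∑ n ∈ Finset.Icc 1 N, sStar k n

/-- The binomial coefficient `binom(z, n) = z(z-1)⋯(z-n+1)/n!` for complex `z`. -/
noncomputable def cbinom (z : ℂ) (n : ℕ) : ℂ :=
  (descPochhammer ℂ n).eval z / (n.factorial : ℂ)

/-- The Kawashima function
`F_k(z) = Σ_{n=1}^∞ (-1)^{n-1} s⋆(k∨, n) binom(z, n)`, with `F_∅(z) = 1`. -/
noncomputable def F (k : List ℕ) (z : ℂ) : ℂ :=
  if k = [] then 1
  else ∑' n : ℕ, (-1 : ℂ) ^ n * ((sStar (hdual k) (n + 1) : ℝ) : ℂ) * cbinom z (n + 1)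

/-- The domain `Δ(k) ⊆ (0,1)^{wt(k)}`: `t_j < t_{j+1}` if `j ∈ A(k)` and
`t_j > t_{j+1}` otherwise (positions `1`-indexed). -/
def Delta (k : List ℕ) : Set (Fin k.sum → ℝ) :=
  {t | (∀ j, t j ∈ Set.Ioo (0 : ℝ) 1) ∧
       ∀ (i : Fin k.sum) (h : (i : ℕ) + 1 < k.sum),
         if (i : ℕ) + 1 ∈ Aset k then t i < t ⟨(i : ℕ) + 1, h⟩
         else t ⟨(i : ℕ) + 1, h⟩ < t i}

/-- The multiple zeta value `ζ(k) = Σ_{0 < m₁ < ⋯ < m_r} 1/(m₁^{k₁} ⋯ m_r^{k_r})`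
(as a `tsum`; it converges for admissible `k`), with `ζ(∅) = 1`. -/
noncomputable def mzv (k : List ℕ) : ℝ :=
  ∑' m : Fin k.length → ℕ,
    if (∀ i, 0 < m i) ∧ (∀ i j : Fin k.length, i < j → m i < m j)
    then ∏ i : Fin k.length, 1 / ((m i : ℕ) : ℝ) ^ k.get i
    else 0

/-- `ζ` extended `ℚ`-linearly to formal `ℚ`-linear combinations of indices. -/
noncomputable def zetaL (v : List ℕ →₀ ℚ) : ℝ :=
  v.sum fun k a => (a : ℝ) * mzv k

/-- The Kawashima function extended `ℚ`-linearly to formal combinations of indices. -/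
noncomputable def FL (v : List ℕ →₀ ℚ) (z : ℂ) : ℂ :=
  v.sum fun k a => (a : ℂ) * F k z

/-- Auxiliary harmonic product, on *reversed* indices (so that the rightmost entry of
the index is the head of the list):
`k * l = (k₋ * l, k_r) + (k * l₋, l_s) + (k₋ * l₋, k_r + l_s)`. -/
noncomputable def hstarAux : List ℕ → List ℕ → (List ℕ →₀ ℚ)
  | [], l => Finsupp.single l 1
  | a :: k, [] => Finsupp.single (a :: k) 1
  | a :: k, b :: l =>
      Finsupp.mapDomain (List.cons a) (hstarAux k (b :: l)) +
      Finsupp.mapDomain (List.cons b) (hstarAux (a :: k) l) +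
      Finsupp.mapDomain (List.cons (a + b)) (hstarAux k l)
  termination_by k l => k.length + l.length

/-- The harmonic product `k * l` of two indices, as a `ℚ`-linear combination of
indices. -/
noncomputable def hstar (k l : List ℕ) : List ℕ →₀ ℚ :=
  Finsupp.mapDomain List.reverse (hstarAux k.reverse l.reverse)

/-- Auxiliary product `*̄` on reversed indices:
`k *̄ l = (k₋ *̄ l, k_r) + (k *̄ l₋, l_s) - (k₋ *̄ l₋, k_r + l_s)`. -/
noncomputable def hbarAux : List ℕ → List ℕ → (List ℕ →₀ ℚ)
  | [], l => Finsupp.single l 1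
  | a :: k, [] => Finsupp.single (a :: k) 1
  | a :: k, b :: l =>
      Finsupp.mapDomain (List.cons a) (hbarAux k (b :: l)) +
      Finsupp.mapDomain (List.cons b) (hbarAux (a :: k) l) -
      Finsupp.mapDomain (List.cons (a + b)) (hbarAux k l)
  termination_by k l => k.length + l.length

/-- The harmonic product `k *̄ l` of two indices. -/
noncomputable def hbar (k l : List ℕ) : List ℕ →₀ ℚ :=
  Finsupp.mapDomain List.reverse (hbarAux k.reverse l.reverse)

/-- The product `k ⊛ l = (k₋ * l₋, k_r + l_s)` for nonempty indices `k`, `l`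
(and `0` if either is empty). -/
noncomputable def circAst (k l : List ℕ) : List ℕ →₀ ℚ :=
  match k.reverse, l.reverse with
  | a :: k', b :: l' =>
      Finsupp.mapDomain List.reverse
        (Finsupp.mapDomain (List.cons (a + b)) (hstarAux k' l'))
  | _, _ => 0

/-- `⊛` extended bilinearly to formal combinations. -/
noncomputable def circAstL (v w : List ℕ →₀ ℚ) : List ℕ →₀ ℚ :=
  v.sum fun k a => w.sum fun l b => (a * b) • circAst k l

/-- The star operator `k ↦ k⋆`: the sum over all ways to replace commas by pluses
in groups of consecutive entries,
`(k₁,…,k_r)⋆ = Σ_{0<j₁<⋯<j_q=r} (k₁+⋯+k_{j₁}, …, k_{j_{q-1}+1}+⋯+k_{j_q})`. -/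
noncomputable def starOp : List ℕ → (List ℕ →₀ ℚ)
  | [] => Finsupp.single [] 1
  | [a] => Finsupp.single [a] 1
  | a :: b :: k =>
      Finsupp.mapDomain (List.cons a) (starOp (b :: k)) + starOp ((a + b) :: k)
  termination_by k => k.length

/-- The star operator extended `ℚ`-linearly. -/
noncomputable def starL (v : List ℕ →₀ ℚ) : List ℕ →₀ ℚ :=
  v.sum fun k a => a • starOp k

open Classical in
/-- Kawashima's function `G_k(z)`: the sum over tuples `0 < n₁, …, n_w` with
`n_j < n_{j+1}` if `j ∉ A(k)` and `n_j ≤ n_{j+1}` if `j ∈ A(k)`, of the product of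
the factors `1/(n_j + z)` at positions `j ∈ A(k)`, the factor
`1/n_w - 1/(n_w + z)` at the last position, and `1/n_j` elsewhere. -/
noncomputable def G (k : List ℕ) (z : ℂ) : ℂ :=
  ∑' n : Fin k.sum → ℕ,
    if (∀ j, 0 < n j) ∧
       (∀ (i : Fin k.sum) (h : (i : ℕ) + 1 < k.sum),
          if (i : ℕ) + 1 ∈ Aset k then n i ≤ n ⟨(i : ℕ) + 1, h⟩
          else n i < n ⟨(i : ℕ) + 1, h⟩)
    then ∏ j : Fin k.sum,
      if (j : ℕ) + 1 = k.sum then 1 / ((n j : ℕ) : ℂ) - 1 / (((n j : ℕ) : ℂ) + z)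
      else if (j : ℕ) + 1 ∈ Aset k then 1 / (((n j : ℕ) : ℂ) + z)
      else 1 / ((n j : ℕ) : ℂ)
    else 0

open Classical in
/-- `ζ_k(l) = Σ 1/(n₁^{l₁} ⋯ n_w^{l_w})`, summed over the same set of tuples as in
the definition of `G_k`. -/
noncomputable def zetaIdx (k : List ℕ) (l : List ℕ) : ℝ :=
  ∑' n : Fin k.sum → ℕ,
    if (∀ j, 0 < n j) ∧
       (∀ (i : Fin k.sum) (h : (i : ℕ) + 1 < k.sum),
          if (i : ℕ) + 1 ∈ Aset k then n i ≤ n ⟨(i : ℕ) + 1, h⟩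
          else n i < n ⟨(i : ℕ) + 1, h⟩)
    then ∏ j : Fin k.sum, 1 / ((n j : ℕ) : ℝ) ^ (l.getD (j : ℕ) 0)
    else 0

/-- `C_m(k) = Σ_{l₁,…,l_{r-1} ≥ 0, l_r ≥ 1, l₁+⋯+l_r = m}
ζ_k(1,…,1 (k₁-1 ones), l₁+1, …, 1,…,1 (k_r-1 ones), l_r+1)`. -/
noncomputable def Cm (k : List ℕ) (m : ℕ) : ℝ :=
  ∑ l : Fin k.length → Fin (m + 1),
    if (∑ i, (l i : ℕ)) = m ∧
       (∀ i : Fin k.length, (i : ℕ) + 1 = k.length → 1 ≤ (l i : ℕ))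
    then zetaIdx k
      ((List.ofFn (fun i : Fin k.length =>
          List.replicate (k.get i - 1) 1 ++ [(l i : ℕ) + 1])).flatten)
    else 0

/-- The iterated integral `A_m(k)` over `Δ((k,1,…,1))` (`m` trailing ones) of
`ω_{δ(1)}(t₁) ⋯ ω_{δ(w-1)}(t_{w-1}) · dt_w/(1-t_w) · dt_{w+1}/t_{w+1} ⋯ dt_{w+m}/t_{w+m}`. -/
noncomputable def Aint (k : List ℕ) (m : ℕ) : ℝ :=
  ∫ t in Delta (k ++ List.replicate m 1),
    ∏ i : Fin (k ++ List.replicate m 1).sum,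
      if (i : ℕ) + 1 < k.sum then
        (if (i : ℕ) + 1 ∈ Aset k then 1 / (1 - t i) else 1 / t i)
      else if (i : ℕ) + 1 = k.sum then 1 / (1 - t i)
      else 1 / t i

/-- The digamma function `ψ(z) = Γ'(z)/Γ(z)`. -/
noncomputable def digamma (z : ℂ) : ℂ := deriv Complex.Gamma z / Complex.Gamma z

theorem cbinom_zero_right (z : ℂ) : cbinom z 0 = 1 := by
  simp [cbinom]

theorem cbinom_zero_succ (n : ℕ) : cbinom 0 (n + 1) = 0 := by
  simp [cbinom, descPochhammer_succ_left]

theorem cbinom_succ (z : ℂ) (n : ℕ) :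
    cbinom z (n + 1) = cbinom z n * ((z - n) / (n + 1)) := by
  have h1 : ((n.factorial : ℕ) : ℂ) ≠ 0 := by exact_mod_cast n.factorial_ne_zero
  have h2 : ((n : ℂ) + 1) ≠ 0 := by exact_mod_cast n.succ_ne_zero
  rw [cbinom, cbinom, descPochhammer_succ_eval, Nat.factorial_succ]
  push_cast
  field_simp

theorem cbinom_add_one_succ (z : ℂ) (n : ℕ) :
    cbinom (z + 1) (n + 1) = (z + 1) / (n + 1) * cbinom z n := by
  have h1 : ((n.factorial : ℕ) : ℂ) ≠ 0 := by exact_mod_cast n.factorial_ne_zero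
  have h2 : ((n : ℂ) + 1) ≠ 0 := by exact_mod_cast n.succ_ne_zero
  rw [cbinom, cbinom, descPochhammer_succ_left, Nat.factorial_succ]
  simp only [Polynomial.eval_mul, Polynomial.eval_X, Polynomial.eval_comp, Polynomial.eval_sub,
    Polynomial.eval_one, add_sub_cancel_right]
  push_cast
  field_simp

theorem cbinom_pascal (z : ℂ) (n : ℕ) :
    cbinom (z + 1) (n + 1) = cbinom z (n + 1) + cbinom z n := by
  have h2 : ((n : ℂ) + 1) ≠ 0 := by exact_mod_cast n.succ_ne_zero
  rw [cbinom_add_one_succ, cbinom_succ]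
  field_simp
  ring

theorem norm_one_sub_div_le_exp (w : ℂ) {m : ℝ} (hm : 0 < m) :
    ‖1 - w / m‖ ≤ Real.exp (-w.re / m + ‖w‖ ^ 2 / 2 * (1 / m ^ 2)) := by
  refine (sq_le_sq₀ (norm_nonneg _) (Real.exp_pos _).le).1 ?_
  have h : ‖1 - w / m‖ ^ 2 = 2 * (-w.re / m + ‖w‖ ^ 2 / 2 * (1 / m ^ 2)) + 1 := by
    rw [Complex.sq_norm, Complex.sq_norm, Complex.normSq_apply, Complex.normSq_apply]
    simp only [Complex.sub_re, Complex.sub_im, Complex.one_re, Complex.one_im,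
      Complex.div_ofReal_re, Complex.div_ofReal_im]
    field_simp
    ring
  rw [h, ← Real.exp_nat_mul]
  exact Real.add_one_le_exp _

/-- `binom(z, n) = O(n ^ (-Re z - 1))`. -/
theorem exists_norm_cbinom_le (z : ℂ) (hz : -1 < z.re) :
    ∃ C, 0 ≤ C ∧ ∀ n : ℕ, ‖cbinom z n‖ ≤ C * ((n : ℝ) + 1) ^ (-(z.re + 1)) := by
  set x := z.re + 1 with hx
  have hx0 : 0 < x := by linarith
  set K := ‖z + 1‖ ^ 2 / 2 with hK
  have hK0 : 0 ≤ K := by positivity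
  have hs : Summable fun n : ℕ => 1 / ((n : ℝ) + 1) ^ 2 := by
    have := (summable_nat_add_iff 1).2 (Real.summable_one_div_nat_pow.2 one_lt_two)
    simpa using this
  have key : ∀ n : ℕ, ‖cbinom z n‖ ≤
      Real.exp (K * ∑ i ∈ Finset.range n, 1 / ((i : ℝ) + 1) ^ 2) * ((n : ℝ) + 1) ^ (-x) := by
    intro n
    induction n with
    | zero => simp [cbinom_zero_right]
    | succ n ih =>
      have hn : (0 : ℝ) < (n : ℝ) + 1 := by positivity
      have hn' : ((n : ℂ) + 1) ≠ 0 := by exact_mod_cast n.succ_ne_zero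
      have h1 : ‖(z - n) / ((n : ℂ) + 1)‖ ≤
          Real.exp (-x / ((n : ℝ) + 1) + K * (1 / ((n : ℝ) + 1) ^ 2)) := by
        have := norm_one_sub_div_le_exp (z + 1) hn
        have e : (z - n) / ((n : ℂ) + 1) = -(1 - (z + 1) / (((n : ℝ) + 1 : ℝ) : ℂ)) := by
          push_cast
          field_simp
          ring
        rw [e, norm_neg]
        simpa [hx, hK] using this
      have h2 : ((n : ℝ) + 1) ^ (-x) * Real.exp (-x / ((n : ℝ) + 1)) ≤
          ((n : ℝ) + 1 + 1) ^ (-x) := by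
        have h3 : ((n : ℝ) + 1 + 1) ≤ ((n : ℝ) + 1) * Real.exp (1 / ((n : ℝ) + 1)) := by
          have := mul_le_mul_of_nonneg_left (Real.add_one_le_exp (1 / ((n : ℝ) + 1))) hn.le
          refine le_trans (le_of_eq ?_) this
          field_simp
          ring
        have h4 := Real.rpow_le_rpow_of_nonpos (by positivity) h3 (neg_nonpos.2 hx0.le)
        rw [Real.mul_rpow hn.le (Real.exp_pos _).le, ← Real.exp_mul] at h4
        convert h4 using 3
        ring
      rw [cbinom_succ, norm_mul, Finset.sum_range_succ]
      push_cast
      calc ‖cbinom z n‖ * ‖(z - n) / ((n : ℂ) + 1)‖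
          ≤ (Real.exp (K * ∑ i ∈ Finset.range n, 1 / ((i : ℝ) + 1) ^ 2) * ((n : ℝ) + 1) ^ (-x)) *
            Real.exp (-x / ((n : ℝ) + 1) + K * (1 / ((n : ℝ) + 1) ^ 2)) :=
          mul_le_mul ih h1 (norm_nonneg _) (by positivity)
        _ = Real.exp (K * (∑ i ∈ Finset.range n, 1 / ((i : ℝ) + 1) ^ 2 + 1 / ((n : ℝ) + 1) ^ 2)) *
            (((n : ℝ) + 1) ^ (-x) * Real.exp (-x / ((n : ℝ) + 1))) := by
          rw [Real.exp_add, mul_add, Real.exp_add]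
          ring
        _ ≤ _ := mul_le_mul_of_nonneg_left h2 (Real.exp_pos _).le
  refine ⟨Real.exp (K * ∑' i : ℕ, 1 / ((i : ℝ) + 1) ^ 2), (Real.exp_pos _).le, fun n => ?_⟩
  refine (key n).trans (mul_le_mul_of_nonneg_right ?_ (by positivity))
  refine Real.exp_le_exp.2 (mul_le_mul_of_nonneg_left ?_ hK0)
  exact hs.sum_le_tsum _ fun i _ => by positivity

/-- The sequence `u` is `O(n ^ (ε - 1))` for every `ε > 0`. -/
def AlmostInv (u : ℕ → ℝ) : Prop :=
  ∀ ε : ℝ, 0 < ε → ε < 1 → ∃ C, 0 ≤ C ∧ ∀ n : ℕ, |u n| ≤ C * ((n : ℝ) + 1) ^ (ε - 1)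

theorem AlmostInv.mono {u v : ℕ → ℝ} (hv : AlmostInv v) (h : ∀ n, |u n| ≤ |v n|) :
    AlmostInv u := by
  intro ε h0 h1
  obtain ⟨C, hC, hv⟩ := hv ε h0 h1
  exact ⟨C, hC, fun n => (h n).trans (hv n)⟩

theorem AlmostInv.shift {u : ℕ → ℝ} (hu : AlmostInv u) : AlmostInv fun n => u (n + 1) := by
  intro ε h0 h1
  obtain ⟨C, hC, hu⟩ := hu ε h0 h1
  refine ⟨C, hC, fun n => (hu (n + 1)).trans (mul_le_mul_of_nonneg_left ?_ hC)⟩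
  exact Real.rpow_le_rpow_of_nonpos (by positivity) (by push_cast; linarith) (by linarith)

theorem almostInv_single : AlmostInv (Pi.single 0 1) := by
  intro ε h0 h1
  refine ⟨1, zero_le_one, fun n => ?_⟩
  cases n with
  | zero => simp
  | succ n => simp; positivity

/-- The sequence of averages of `v`. -/
noncomputable def cesaro (v : ℕ → ℝ) (n : ℕ) : ℝ :=
  (∑ m ∈ Finset.range (n + 1), v m) / (n + 1)

theorem sum_rpow_sub_one_le {ε : ℝ} (h0 : 0 < ε) (h1 : ε < 1) (n : ℕ) :
    ∑ m ∈ Finset.range n, ((m : ℝ) + 1) ^ (ε - 1) ≤ (n : ℝ) ^ ε / ε := by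
  induction n with
  | zero => simp [h0.ne']
  | succ n ih =>
    have hn : (0 : ℝ) < (n : ℝ) + 1 := by positivity
    have h := rpow_one_add_le_one_add_mul_self (s := -1 / ((n : ℝ) + 1))
      (by rw [le_div_iff₀ hn]; nlinarith [Nat.cast_nonneg (α := ℝ) n]) h0.le h1.le
    have e : 1 + -1 / ((n : ℝ) + 1) = n / ((n : ℝ) + 1) := by field_simp; ring
    rw [e, Real.div_rpow (Nat.cast_nonneg n) hn.le, div_le_iff₀ (by positivity)] at h
    have h2 : (n : ℝ) ^ ε ≤ ((n : ℝ) + 1) ^ ε - ε * ((n : ℝ) + 1) ^ (ε - 1) := by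
      rw [Real.rpow_sub_one hn.ne']
      refine h.trans (le_of_eq ?_)
      field_simp
      ring
    rw [Finset.sum_range_succ]
    push_cast
    rw [le_div_iff₀ h0] at ih ⊢
    linarith

theorem AlmostInv.abs_sum_le {v : ℕ → ℝ} (hv : AlmostInv v) {ε : ℝ} (h0 : 0 < ε) (h1 : ε < 1) :
    ∃ C, 0 ≤ C ∧ ∀ n : ℕ, |∑ m ∈ Finset.range n, v m| ≤ C * (n : ℝ) ^ ε := by
  obtain ⟨C, hC, hv⟩ := hv ε h0 h1
  refine ⟨C / ε, by positivity, fun n => ?_⟩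
  calc |∑ m ∈ Finset.range n, v m| ≤ ∑ m ∈ Finset.range n, C * ((m : ℝ) + 1) ^ (ε - 1) :=
        (Finset.abs_sum_le_sum_abs _ _).trans (Finset.sum_le_sum fun m _ => hv m)
    _ ≤ C * ((n : ℝ) ^ ε / ε) := by
        rw [← Finset.mul_sum]
        exact mul_le_mul_of_nonneg_left (sum_rpow_sub_one_le h0 h1 n) hC
    _ = C / ε * (n : ℝ) ^ ε := by ring

theorem AlmostInv.cesaro {v : ℕ → ℝ} (hv : AlmostInv v) : AlmostInv (cesaro v) := by
  intro ε h0 h1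
  obtain ⟨C, hC, h⟩ := hv.abs_sum_le h0 h1
  refine ⟨C, hC, fun n => ?_⟩
  have hn : (0 : ℝ) < (n : ℝ) + 1 := by positivity
  have h := h (n + 1)
  rw [Kawashima.cesaro, abs_div, abs_of_pos hn, div_le_iff₀ hn, Real.rpow_sub_one hn.ne']
  push_cast at h
  refine h.trans (le_of_eq ?_)
  field_simp

theorem AlmostInv.tendsto_zero {u : ℕ → ℝ} (hu : AlmostInv u) : Tendsto u atTop (𝓝 0) := by
  obtain ⟨C, hC, h⟩ := hu (1 / 2) (by norm_num) (by norm_num)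
  have h1 : Tendsto (fun n : ℕ => C * ((n : ℝ) + 1) ^ (-(1 / 2 : ℝ))) atTop (𝓝 (C * 0)) := by
    refine Tendsto.const_mul _ ((tendsto_rpow_neg_atTop (by norm_num)).comp ?_)
    exact tendsto_atTop_add_const_right _ _ tendsto_natCast_atTop_atTop
  rw [mul_zero] at h1
  refine squeeze_zero_norm (fun n => ?_) h1
  have := h n
  norm_num at this ⊢
  exact this

theorem AlmostInv.summable_norm {u : ℕ → ℝ} (hu : AlmostInv u) {z : ℂ} (hz : -1 < z.re) :
    Summable fun n : ℕ => |u n| * ‖cbinom z n‖ := by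
  obtain ⟨D, hD, hc⟩ := exists_norm_cbinom_le z hz
  obtain ⟨ε, h0, h1, h2⟩ : ∃ ε : ℝ, 0 < ε ∧ ε < 1 ∧ ε < z.re + 1 := by
    obtain ⟨ε, h0, h⟩ := exists_between (lt_min one_pos (by linarith : 0 < z.re + 1))
    exact ⟨ε, h0, (lt_min_iff.1 h).1, (lt_min_iff.1 h).2⟩
  obtain ⟨C, hC, hu⟩ := hu ε h0 h1
  have hs : Summable fun n : ℕ => ((n : ℝ) + 1) ^ (ε - 1 - (z.re + 1)) := by
    have := (summable_nat_add_iff 1).2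
      (Real.summable_nat_rpow.2 (by linarith : ε - 1 - (z.re + 1) < -1))
    simpa using this
  refine Summable.of_nonneg_of_le (fun n => by positivity) (fun n => ?_) (hs.mul_left (C * D))
  refine (mul_le_mul (hu n) (hc n) (norm_nonneg _) (by positivity)).trans (le_of_eq ?_)
  rw [sub_eq_add_neg (ε - 1), Real.rpow_add (by positivity)]
  ring

/-- The series `∑ (-1)ⁿ u(n) binom(z, n)`. -/
noncomputable def newton (u : ℕ → ℝ) (z : ℂ) : ℂ :=
  ∑' n : ℕ, (-1 : ℂ) ^ n * (u n : ℂ) * cbinom z n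

/-- The series `∑ (-1)ⁿ u(n) binom(z, n + 1)`. -/
noncomputable def newtonSucc (u : ℕ → ℝ) (z : ℂ) : ℂ :=
  ∑' n : ℕ, (-1 : ℂ) ^ n * (u n : ℂ) * cbinom z (n + 1)

theorem AlmostInv.summable {u : ℕ → ℝ} (hu : AlmostInv u) {z : ℂ} (hz : -1 < z.re) :
    Summable fun n : ℕ => (-1 : ℂ) ^ n * (u n : ℂ) * cbinom z n :=
  Summable.of_norm (by simpa using hu.summable_norm hz)

theorem AlmostInv.summable_norm_succ {u : ℕ → ℝ} (hu : AlmostInv u) {z : ℂ} (hz : -1 < z.re) :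
    Summable fun n : ℕ => |u n| * ‖cbinom z (n + 1)‖ := by
  have hu' : AlmostInv fun n => u (n - 1) := by
    intro ε h0 h1
    obtain ⟨C, hC, h⟩ := hu ε h0 h1
    refine ⟨2 * C, by positivity, fun n => ?_⟩
    cases n with
    | zero => simpa using (h 0).trans (by simp; linarith)
    | succ n =>
      refine (h n).trans ?_
      have h2 : ((2 : ℝ) * ((n : ℝ) + 1)) ^ (ε - 1) ≤ (((n + 1 : ℕ) : ℝ) + 1) ^ (ε - 1) :=
        Real.rpow_le_rpow_of_nonpos (by positivity)
          (by push_cast; linarith [Nat.cast_nonneg (α := ℝ) n]) (by linarith)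
      rw [Real.mul_rpow (by norm_num) (by positivity)] at h2
      have h3 : (2 : ℝ)⁻¹ ≤ 2 ^ (ε - 1) := by
        rw [← Real.rpow_neg_one]
        exact Real.rpow_le_rpow_of_exponent_le one_le_two (by linarith)
      have h4 : (0 : ℝ) ≤ ((n : ℝ) + 1) ^ (ε - 1) := by positivity
      have h5 := mul_le_mul_of_nonneg_right h3 h4
      nlinarith
  exact (summable_nat_add_iff 1).2 (hu'.summable_norm hz)

theorem AlmostInv.summable_succ {u : ℕ → ℝ} (hu : AlmostInv u) {z : ℂ} (hz : -1 < z.re) :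
    Summable fun n : ℕ => (-1 : ℂ) ^ n * (u n : ℂ) * cbinom z (n + 1) :=
  Summable.of_norm (by simpa using hu.summable_norm_succ hz)

theorem newtonSucc_zero (u : ℕ → ℝ) : newtonSucc u 0 = 0 := by
  simp [newtonSucc, cbinom_zero_succ]

theorem newton_zero (u : ℕ → ℝ) : newton u 0 = u 0 := by
  rw [newton, tsum_eq_single 0]
  · simp [cbinom_zero_right]
  · intro n hn
    obtain ⟨m, rfl⟩ := Nat.exists_eq_succ_of_ne_zero hn
    simp [cbinom_zero_succ]

theorem newtonSucc_add_one {u : ℕ → ℝ} (hu : AlmostInv u) {z : ℂ} (hz : -1 < z.re) :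
    newtonSucc u (z + 1) = newtonSucc u z + newton u z := by
  rw [newtonSucc, newtonSucc, newton, ← (hu.summable_succ hz).tsum_add (hu.summable hz)]
  exact tsum_congr fun n => by rw [cbinom_pascal]; ring

theorem newton_eq_sub {u : ℕ → ℝ} (hu : AlmostInv u) {z : ℂ} (hz : -1 < z.re) :
    newton u z = u 0 - newtonSucc (fun n => u (n + 1)) z := by
  rw [newton, (hu.summable hz).tsum_eq_zero_add, newtonSucc, sub_eq_add_neg, ← tsum_neg]
  congr 1
  · simp [cbinom_zero_right]
  · exact tsum_congr fun n => by ring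

/-- The negated forward difference `u(n) - u(n + 1)`. -/
def bdiff (u : ℕ → ℝ) (n : ℕ) : ℝ := u n - u (n + 1)

theorem newton_add_one {u : ℕ → ℝ} (hu : AlmostInv u) {z : ℂ} (hz : -1 < z.re) :
    newton u (z + 1) = newton (bdiff u) z := by
  have hz' : -1 < (z + 1).re := by simp; linarith
  rw [newton_eq_sub hu hz', newtonSucc_add_one hu.shift hz, ← sub_sub, ← newton_eq_sub hu hz,
    newton, newton, newton, ← (hu.summable hz).tsum_sub (hu.shift.summable hz)]
  exact tsum_congr fun n => by simp only [bdiff]; push_cast; ring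

theorem newton_of_div {u v : ℕ → ℝ} (h : ∀ n, u n = v n / (n + 1)) {z : ℂ} (hz : -1 < z.re) :
    newton u z = newtonSucc v (z + 1) / (z + 1) := by
  have hz0 : z + 1 ≠ 0 := fun h => by
    have := congrArg Complex.re h
    simp at this
    linarith
  rw [newton, newtonSucc, ← tsum_div_const]
  refine tsum_congr fun n => ?_
  have h2 : ((n : ℂ) + 1) ≠ 0 := by exact_mod_cast n.succ_ne_zero
  rw [cbinom_add_one_succ, h]
  push_cast
  field_simp

theorem sum_newton_partialSum (v : ℕ → ℝ) (z : ℂ) (N : ℕ) :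
    ∑ n ∈ Finset.range N,
        (-1 : ℂ) ^ n * ((∑ m ∈ Finset.range (n + 1), v m : ℝ) : ℂ) * cbinom (z + 1) (n + 1) =
      ∑ n ∈ Finset.range N, (-1 : ℂ) ^ n * (v n : ℂ) * cbinom z n -
        (-1) ^ N * ((∑ m ∈ Finset.range N, v m : ℝ) : ℂ) * cbinom z N := by
  induction N with
  | zero => simp
  | succ N ih =>
    rw [Finset.sum_range_succ, ih, cbinom_pascal,
      Finset.sum_range_succ (fun n => (-1 : ℂ) ^ n * (v n : ℂ) * cbinom z n),
      Finset.sum_range_succ v]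
    push_cast
    ring

theorem newton_cesaro {v : ℕ → ℝ} (hv : AlmostInv v) {z : ℂ} (hz : -1 < z.re) :
    newton (cesaro v) z = newton v z / (z + 1) := by
  have hz0 : z + 1 ≠ 0 := fun h => by
    have := congrArg Complex.re h
    simp at this
    linarith
  obtain ⟨D, hD, hc⟩ := exists_norm_cbinom_le z hz
  obtain ⟨ε, h0, h1, h2⟩ : ∃ ε : ℝ, 0 < ε ∧ ε < 1 ∧ ε < z.re + 1 := by
    obtain ⟨ε, h0, h⟩ := exists_between (lt_min one_pos (by linarith : 0 < z.re + 1))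
    exact ⟨ε, h0, (lt_min_iff.1 h).1, (lt_min_iff.1 h).2⟩
  obtain ⟨C, hC, hV⟩ := hv.abs_sum_le h0 h1
  have hbd : Tendsto (fun N : ℕ =>
      (-1 : ℂ) ^ N * ((∑ m ∈ Finset.range N, v m : ℝ) : ℂ) * cbinom z N) atTop (𝓝 0) := by
    have hl : Tendsto (fun n : ℕ => C * D * ((n : ℝ) + 1) ^ (-(z.re + 1 - ε))) atTop
        (𝓝 (C * D * 0)) := by
      refine Tendsto.const_mul _ ((tendsto_rpow_neg_atTop (by linarith)).comp ?_)
      exact tendsto_atTop_add_const_right _ _ tendsto_natCast_atTop_atTop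
    rw [mul_zero] at hl
    refine squeeze_zero_norm (fun n => ?_) hl
    rw [norm_mul, norm_mul, norm_pow, norm_neg, norm_one, one_pow, one_mul, Complex.norm_real,
      Real.norm_eq_abs]
    have h3 : (n : ℝ) ^ ε ≤ ((n : ℝ) + 1) ^ ε :=
      Real.rpow_le_rpow (by positivity) (by linarith) h0.le
    refine (mul_le_mul ((hV n).trans (mul_le_mul_of_nonneg_left h3 hC)) (hc n) (norm_nonneg _)
      (by positivity)).trans (le_of_eq ?_)
    rw [show -(z.re + 1 - ε) = ε + -(z.re + 1) by ring, Real.rpow_add (by positivity)]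
    ring
  have hL := (hv.cesaro.summable hz).hasSum.mul_left (z + 1)
  have hL' : HasSum (fun n : ℕ => (-1 : ℂ) ^ n * ((∑ m ∈ Finset.range (n + 1), v m : ℝ) : ℂ) *
      cbinom (z + 1) (n + 1)) ((z + 1) * newton (cesaro v) z) := by
    refine hL.congr_fun fun n => ?_
    have h2 : ((n : ℂ) + 1) ≠ 0 := by exact_mod_cast n.succ_ne_zero
    rw [cbinom_add_one_succ, cesaro]
    push_cast
    field_simp
  have hR := ((hv.summable hz).hasSum.tendsto_sum_nat).sub hbd
  rw [sub_zero] at hR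
  have := tendsto_nhds_unique
    (hL'.tendsto_sum_nat.congr fun N => sum_newton_partialSum v z N) hR
  rw [eq_div_iff hz0, mul_comm, this, newton]

/-- All iterated negated differences of `u` are nonnegative. -/
def CompletelyMonotone (u : ℕ → ℝ) : Prop := ∀ N n, 0 ≤ bdiff^[N] u n

theorem bdiff_iterate_succ (u : ℕ → ℝ) (N n : ℕ) :
    bdiff^[N + 1] u n = bdiff^[N] u n - bdiff^[N] u (n + 1) := by
  rw [Function.iterate_succ_apply', bdiff]

theorem completelyMonotone_single : CompletelyMonotone (Pi.single 0 1) := by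
  have h : bdiff (Pi.single 0 1) = Pi.single 0 1 := by
    ext n
    cases n <;> simp [bdiff]
  intro N n
  rw [Function.iterate_fixed h]
  cases n <;> simp

theorem bdiff_iterate_cesaro (v : ℕ → ℝ) (N : ℕ) :
    ((N : ℝ) + 1) * bdiff^[N] (cesaro v) 0 = bdiff^[N] v 0 ∧
      ∀ n : ℕ, ((n : ℝ) + N + 2) * bdiff^[N] (cesaro v) (n + 1) =
        ((n : ℝ) + 1) * bdiff^[N] (cesaro v) n + bdiff^[N] v (n + 1) := by
  induction N with
  | zero =>
    refine ⟨by simp [cesaro], fun n => ?_⟩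
    simp only [Function.iterate_zero, id, cesaro]
    rw [Finset.sum_range_succ v (n + 1)]
    push_cast
    field_simp
    ring
  | succ N ih =>
    obtain ⟨h0, h⟩ := ih
    constructor
    · have := h 0
      rw [bdiff_iterate_succ, bdiff_iterate_succ]
      push_cast at this ⊢
      linear_combination h0 - this
    · intro n
      have h1 := h n
      have h2 := h (n + 1)
      rw [bdiff_iterate_succ, bdiff_iterate_succ, bdiff_iterate_succ]
      push_cast at h1 h2 ⊢
      linear_combination h1 - h2

theorem CompletelyMonotone.cesaro {v : ℕ → ℝ} (hv : CompletelyMonotone v) :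
    CompletelyMonotone (cesaro v) := by
  intro N n
  obtain ⟨h0, h⟩ := bdiff_iterate_cesaro v N
  induction n with
  | zero => exact nonneg_of_mul_nonneg_right (h0 ▸ hv N 0) (by positivity)
  | succ n ih =>
    refine nonneg_of_mul_nonneg_right (a := (n : ℝ) + N + 2) ?_ (by positivity)
    rw [h]
    have := hv N (n + 1)
    positivity

theorem CompletelyMonotone.of_div {u v : ℕ → ℝ} (hv : CompletelyMonotone v)
    (huv : ∀ n, u n = v n / (n + 1)) : CompletelyMonotone u := by
  have h : ∀ N n : ℕ, ((n : ℝ) + 1) * bdiff^[N + 1] u n =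
      bdiff^[N + 1] v n + (N + 1) * bdiff^[N] u (n + 1) := by
    intro N
    induction N with
    | zero =>
      intro n
      simp only [zero_add, Function.iterate_one, Function.iterate_zero, id, bdiff, huv]
      push_cast
      field_simp
      ring
    | succ N ih =>
      intro n
      have h1 := ih n
      have h2 := ih (n + 1)
      have h3 := bdiff_iterate_succ u N (n + 1)
      rw [bdiff_iterate_succ u (N + 1), bdiff_iterate_succ v (N + 1)]
      push_cast at h1 h2 ⊢
      linear_combination h1 - h2 - (N + 1) * h3
  intro N
  induction N with
  | zero =>
    intro n
    have := hv 0 n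
    simp only [Function.iterate_zero, id, huv] at this ⊢
    positivity
  | succ N ih =>
    intro n
    refine nonneg_of_mul_nonneg_right (a := (n : ℝ) + 1) ?_ (by positivity)
    rw [h]
    have h1 := hv (N + 1) n
    have h2 := ih (n + 1)
    positivity

theorem CompletelyMonotone.bdiff_iterate_le {u : ℕ → ℝ} (hu : CompletelyMonotone u) (N n : ℕ) :
    bdiff^[N] u n ≤ u n := by
  induction N with
  | zero => rfl
  | succ N ih =>
    have := bdiff_iterate_succ u N n
    linarith [hu N (n + 1)]

theorem AlmostInv.bdiff_iterate {u : ℕ → ℝ} (hu : AlmostInv u) (hc : CompletelyMonotone u)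
    (N : ℕ) : AlmostInv (bdiff^[N] u) :=
  hu.mono fun n => by
    rw [abs_of_nonneg (hc N n)]
    exact (hc.bdiff_iterate_le N n).trans (le_abs_self _)

theorem sum_bdiff_iterate (u : ℕ → ℝ) (M n : ℕ) :
    ∑ N ∈ Finset.range M, bdiff^[N] u (n + 1) = u n - bdiff^[M] u n := by
  induction M with
  | zero => simp
  | succ M ih =>
    rw [Finset.sum_range_succ, ih, bdiff_iterate_succ]
    ring

theorem CompletelyMonotone.hasSum_bdiff_iterate {u : ℕ → ℝ} (hu : CompletelyMonotone u)
    (h0 : Tendsto (fun N => bdiff^[N] u 0) atTop (𝓝 0)) (n : ℕ) :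
    HasSum (fun N => bdiff^[N] u (n + 1)) (u n) := by
  have hs : ∀ n, Summable fun N => bdiff^[N] u (n + 1) := fun n =>
    summable_of_sum_range_le (c := u n) (fun N => hu N (n + 1)) fun M => by
      rw [sum_bdiff_iterate]
      linarith [hu M n]
  have ht : Tendsto (fun N => bdiff^[N] u n) atTop (𝓝 0) := by
    cases n with
    | zero => exact h0
    | succ n => exact (hs n).tendsto_atTop_zero
  rw [hasSum_iff_tendsto_nat_of_nonneg fun N => hu N (n + 1)]
  simp_rw [sum_bdiff_iterate]
  simpa using ht.const_sub (u n)

theorem newton_add_natCast {u : ℕ → ℝ} (hu : AlmostInv u) (hc : CompletelyMonotone u) {z : ℂ}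
    (hz : -1 < z.re) (N : ℕ) : newton u (z + N) = newton (bdiff^[N] u) z := by
  induction N generalizing z with
  | zero => simp
  | succ N ih =>
    have hz' : -1 < (z + 1).re := by simp; linarith
    rw [Function.iterate_succ_apply', ← newton_add_one (hu.bdiff_iterate hc N) hz, ← ih hz']
    push_cast
    ring_nf

/-- The Newton series of a completely monotone sequence is the sum of the increments
`u(0) - newton u (z)` along `ℕ`. -/
theorem newtonSucc_eq_tsum {u : ℕ → ℝ} (hu : AlmostInv u) (hc : CompletelyMonotone u)
    (h0 : Tendsto (fun N => bdiff^[N] u 0) atTop (𝓝 0)) {z : ℂ} (hz : -1 < z.re) :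
    newtonSucc u z = ∑' N : ℕ, ((bdiff^[N] u 0 : ℝ) - newton u (z + N)) := by
  have hsum := hc.hasSum_bdiff_iterate h0
  set f : ℕ → ℕ → ℂ := fun n N => (-1 : ℂ) ^ n * (bdiff^[N] u (n + 1) : ℂ) * cbinom z (n + 1)
    with hf
  have hfs : Summable (Function.uncurry f) := by
    refine Summable.of_norm ((summable_prod_of_nonneg fun _ => norm_nonneg _).2 ⟨?_, ?_⟩)
    · intro n
      simpa [Function.uncurry, hf, abs_of_nonneg (hc _ _)] using
        (hsum n).summable.mul_right ‖cbinom z (n + 1)‖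
    · refine (hu.summable_norm_succ hz).congr fun n => ?_
      simp only [Function.uncurry, hf, norm_mul, norm_pow, norm_neg, norm_one, one_pow, one_mul,
        Complex.norm_real, Real.norm_eq_abs, abs_of_nonneg (hc _ _)]
      rw [tsum_mul_right, (hsum n).tsum_eq, abs_of_nonneg (show 0 ≤ u n from hc 0 n)]
  have h1 : newtonSucc u z = ∑' n, ∑' N, f n N := by
    refine tsum_congr fun n => ?_
    simp only [hf]
    rw [tsum_mul_right, tsum_mul_left, ← Complex.ofReal_tsum, (hsum n).tsum_eq]
  rw [h1, ← hfs.tsum_comm]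
  refine tsum_congr fun N => ?_
  rw [newton_add_natCast hu hc hz, newton_eq_sub (hu.bdiff_iterate hc N) hz, sub_sub_cancel]
  rfl

/-- The tuples `0 < m₁ ≤ ⋯ ≤ m_r = N`. -/
noncomputable def chains (r N : ℕ) : Finset (Fin r → ℕ) :=
  open Classical in
  {m ∈ Fintype.piFinset fun _ => Finset.Icc 1 N | Monotone m ∧ ∀ i : Fin r, (i : ℕ) + 1 = r → m i = N}

theorem mem_chains {r N : ℕ} {m : Fin r → ℕ} :
    m ∈ chains r N ↔ (∀ i, 1 ≤ m i ∧ m i ≤ N) ∧ Monotone m ∧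
      ∀ i : Fin r, (i : ℕ) + 1 = r → m i = N := by
  simp [chains, Fintype.mem_piFinset]

theorem sStar_eq_sum_chains (k : List ℕ) (r : ℕ) (h : k.length = r) (N : ℕ) :
    sStar k N = ∑ m ∈ chains r N, ∏ i : Fin r, 1 / (m i : ℝ) ^ k.getD i 0 := by
  subst h
  rw [sStar, ← Finset.sum_filter]
  refine Finset.sum_bij (fun m _ i => (m i : ℕ)) ?_ ?_ ?_ ?_
  · intro m hm
    simp only [Finset.mem_filter, Finset.mem_univ, true_and] at hm
    refine mem_chains.2 ⟨fun i => ⟨hm.1 i, Nat.le_of_lt_succ (m i).2⟩, fun i j => hm.2.1 i j, hm.2.2⟩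
  · intro m _ m' _ h
    ext i
    exact congrFun h i
  · intro m hm
    obtain ⟨h1, h2, h3⟩ := mem_chains.1 hm
    refine ⟨fun i => ⟨m i, Nat.lt_succ_of_le (h1 i).2⟩, ?_, rfl⟩
    simp only [Finset.mem_filter, Finset.mem_univ, true_and]
    exact ⟨fun i => (h1 i).1, fun i j => @h2 i j, h3⟩
  · intro m _
    simp

theorem sStar_singleton (a n : ℕ) : sStar [a] (n + 1) = 1 / ((n : ℝ) + 1) ^ a := by
  have h : chains 1 (n + 1) = {fun _ => n + 1} := by
    ext m
    rw [mem_chains, Finset.mem_singleton]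
    constructor
    · rintro ⟨-, -, h⟩
      ext i
      exact h i (by omega)
    · rintro rfl
      exact ⟨fun _ => by simp, monotone_const, fun _ _ => rfl⟩
  rw [sStar_eq_sum_chains [a] 1 rfl, h]
  simp

theorem sStar_append_singleton {k : List ℕ} (hk : k ≠ []) (a N : ℕ) :
    sStar (k ++ [a]) N = (∑ M ∈ Finset.Icc 1 N, sStar k M) / (N : ℝ) ^ a := by
  obtain ⟨r, hr⟩ : ∃ r, k.length = r + 1 := Nat.exists_eq_succ_of_ne_zero (by simpa using hk)
  rw [sStar_eq_sum_chains (k ++ [a]) (r + 1 + 1) (by simp [hr]), Finset.sum_div]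
  simp_rw [sStar_eq_sum_chains k (r + 1) hr, Finset.sum_div]
  rw [Finset.sum_sigma']
  refine Finset.sum_bij' (fun m _ => ⟨Fin.init m (Fin.last r), Fin.init m⟩)
    (fun x _ => Fin.snoc (α := fun _ => ℕ) x.2 N) ?_ ?_ ?_ ?_ ?_
  · intro m hm
    obtain ⟨h1, h2, h3⟩ := mem_chains.1 hm
    simp only [Finset.mem_sigma, Finset.mem_Icc]
    refine ⟨h1 _, mem_chains.2 ⟨fun i => ⟨(h1 _).1, h2 ?_⟩, fun i j hij => h2 (by simpa using hij),
      fun i hi => ?_⟩⟩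
    · exact Fin.castSucc_le_castSucc_iff.2 (Fin.le_last i)
    · rw [show i = Fin.last r from Fin.ext (by simpa using hi)]
  · rintro ⟨M, m⟩ hm
    simp only [Finset.mem_sigma, Finset.mem_Icc] at hm
    obtain ⟨hM, hm⟩ := hm
    obtain ⟨h1, h2, -⟩ := mem_chains.1 hm
    refine mem_chains.2 ⟨fun i => ?_, fun i j hij => ?_, fun i hi => ?_⟩
    · refine Fin.lastCases ?_ (fun i => ?_) i
      · simp only [Fin.snoc_last]
        omega
      · simp only [Fin.snoc_castSucc]
        exact ⟨(h1 i).1, (h1 i).2.trans hM.2⟩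
    · revert hij
      refine Fin.lastCases ?_ (fun j => ?_) j
      · intro _
        refine Fin.lastCases (le_refl _) (fun i => ?_) i
        simp only [Fin.snoc_castSucc, Fin.snoc_last]
        exact (h1 i).2.trans hM.2
      · refine Fin.lastCases (fun h => ?_) (fun i h => ?_) i
        · exact absurd h (not_le.2 (Fin.castSucc_lt_last j))
        · simp only [Fin.snoc_castSucc]
          exact h2 (by simpa using h)
    · rw [show i = Fin.last (r + 1) from Fin.ext (by simpa using hi), Fin.snoc_last]
  · intro m hm
    rw [← (mem_chains.1 hm).2.2 (Fin.last (r + 1)) (by simp), Fin.snoc_init_self]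
  · rintro ⟨M, m⟩ hm
    simp only [Finset.mem_sigma] at hm
    have := (mem_chains.1 hm.2).2.2 (Fin.last r) (by simp)
    simp only [Fin.init_snoc]
    rw [this]
  · intro m hm
    rw [Fin.prod_univ_castSucc, (mem_chains.1 hm).2.2 (Fin.last (r + 1)) (by simp), div_eq_mul_one_div]
    congr 1
    · refine Finset.prod_congr rfl fun i _ => ?_
      rw [List.getD_append _ _ _ _ (by simp [hr]; omega)]
      rfl
    · rw [List.getD_append_right _ _ _ _ (by simp [hr])]
      simp [hr]

theorem sStar_append_succ (l : List ℕ) (b n : ℕ) :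
    sStar (l ++ [b + 1]) (n + 1) = sStar (l ++ [b]) (n + 1) / ((n : ℝ) + 1) := by
  rcases eq_or_ne l [] with rfl | hl
  · rw [List.nil_append, List.nil_append, sStar_singleton, sStar_singleton, pow_succ]
    field_simp
  · rw [sStar_append_singleton hl, sStar_append_singleton hl, pow_succ, div_div]
    push_cast
    rfl

theorem sum_Icc_one_eq_sum_range (f : ℕ → ℝ) (n : ℕ) :
    ∑ m ∈ Finset.Icc 1 n, f m = ∑ m ∈ Finset.range n, f (m + 1) := by
  rw [Finset.range_eq_Ico, Finset.sum_Ico_add' f 0 n 1]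
  rfl

theorem Aset_append_singleton (k : List ℕ) (a : ℕ) :
    Aset (k ++ [a]) = (Finset.Ico 1 (k.length + 1)).image fun i => (k.take i).sum := by
  rw [Aset, List.length_append, List.length_singleton]
  refine Finset.image_congr fun i hi => ?_
  simp only [Finset.coe_Ico, Set.mem_Ico] at hi
  rw [List.take_append_of_le_length (by omega)]

theorem zipWith_append_singleton (f : ℕ → ℕ → ℕ) (L : List ℕ) (x c : ℕ) :
    (L ++ [x]).zipWith f (c :: (L ++ [x])) =
      L.zipWith f (c :: L) ++ [f x ((c :: L).getLast (List.cons_ne_nil _ _))] := by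
  induction L generalizing c with
  | nil => simp
  | cons y L ih =>
    rw [List.cons_append, List.zipWith_cons_cons, ih, List.zipWith_cons_cons, List.cons_append,
      List.getLast_cons (List.cons_ne_nil y L)]

theorem sort_insert_of_lt {s : Finset ℕ} {x : ℕ} (h : ∀ y ∈ s, y < x) :
    (insert x s).sort (· ≤ ·) = s.sort (· ≤ ·) ++ [x] := by
  have hx : x ∉ s := fun hx => (h x hx).false
  refine List.Perm.eq_of_pairwise' (r := (· ≤ ·)) (Finset.pairwise_sort _ _) ?_ ?_
  · refine List.pairwise_append.2 ⟨Finset.pairwise_sort _ _, List.pairwise_singleton _ _, ?_⟩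
    intro a ha b hb
    rw [List.mem_singleton.1 hb]
    exact (h a ((Finset.mem_sort _).1 ha)).le
  · refine (List.perm_ext_iff_of_nodup (Finset.sort_nodup _ _) ?_).2 fun a => by
      simp [or_comm]
    refine List.nodup_append.2 ⟨Finset.sort_nodup _ _, List.nodup_singleton x, ?_⟩
    intro a ha b hb
    rw [List.mem_singleton.1 hb]
    exact (h a ((Finset.mem_sort _).1 ha)).ne

theorem hdual_eq {k : List ℕ} (hk : 0 < k.sum) :
    hdual k =
      let L := ((Finset.Icc 1 (k.sum - 1)) \ Aset k).sort (· ≤ ·)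
      L.zipWith (fun a b => a - b) (0 :: L) ++
        [k.sum - (0 :: L).getLast (List.cons_ne_nil _ _)] := by
  rw [hdual]
  simp only
  rw [sort_insert_of_lt, zipWith_append_singleton]
  intro y hy
  simp only [Finset.mem_sdiff, Finset.mem_Icc] at hy
  omega

theorem hdual_one : hdual [1] = [1] := by
  rw [hdual_eq (by simp)]
  simp

theorem hdual_append_one {k : List ℕ} (hk : k ≠ []) (hs : 0 < k.sum) :
    ∃ l b, hdual k = l ++ [b] ∧ hdual (k ++ [1]) = l ++ [b + 1] := by
  have hA : (Finset.Icc 1 ((k ++ [1]).sum - 1)) \ Aset (k ++ [1]) =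
      (Finset.Icc 1 (k.sum - 1)) \ Aset k := by
    have hlen : 1 ≤ k.length := List.length_pos_iff.2 hk
    have hA' : Aset (k ++ [1]) = insert k.sum (Aset k) := by
      rw [Aset_append_singleton, ← Finset.insert_Ico_right_eq_Ico_add_one hlen,
        Finset.image_insert, List.take_length, Aset]
    rw [hA']
    ext y
    simp only [List.sum_append, List.sum_singleton, Finset.mem_sdiff, Finset.mem_Icc,
      Finset.mem_insert]
    by_cases hy : y ∈ Aset k
    · simp [hy]
    · simp only [hy, or_false, not_false_eq_true, and_true]
      omega
  refine ⟨_, _, hdual_eq hs, ?_⟩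
  rw [hdual_eq (by simp), hA]
  simp only [List.sum_append, List.sum_singleton]
  congr 2
  refine Nat.sub_add_comm ?_
  have := List.getLast_mem (List.cons_ne_nil 0
    (((Finset.Icc 1 (k.sum - 1)) \ Aset k).sort (· ≤ ·)))
  simp only [List.mem_cons, Finset.mem_sort, Finset.mem_sdiff, Finset.mem_Icc] at this
  omega

theorem hdual_append_add_two (k : List ℕ) (a : ℕ) :
    hdual (k ++ [a + 2]) = hdual (k ++ [a + 1]) ++ [1] := by
  set w := (k ++ [a + 1]).sum with hw
  have hw' : w = k.sum + (a + 1) := by simp [hw]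
  have hwne : w ∉ Aset (k ++ [a + 1]) := by
    rw [Aset_append_singleton]
    intro h
    obtain ⟨i, -, hi⟩ := Finset.mem_image.1 h
    have := (List.take_sublist i k).sum_le_sum (fun _ _ => Nat.zero_le _)
    omega
  have hA : (Finset.Icc 1 ((k ++ [a + 2]).sum - 1)) \ Aset (k ++ [a + 2]) =
      insert w ((Finset.Icc 1 (w - 1)) \ Aset (k ++ [a + 1])) := by
    rw [Aset_append_singleton k (a + 2), ← Aset_append_singleton k (a + 1)]
    have hs : (k ++ [a + 2]).sum = w + 1 := by simp [hw', add_assoc]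
    ext y
    simp only [hs, Finset.mem_sdiff, Finset.mem_Icc, Finset.mem_insert]
    by_cases hy : y = w
    · subst hy
      simp only [hwne, true_or, iff_true, not_false_iff, and_true]
      omega
    · simp only [hy, false_or]
      refine and_congr_left fun _ => ?_
      omega
  rw [hdual_eq (by simp), hA, sort_insert_of_lt]
  · rw [hdual_eq (k := k ++ [a + 1]) (by simp)]
    simp only
    rw [zipWith_append_singleton, ← hw]
    congr 2
    rw [List.getLast_cons (by simp), List.getLast_append_singleton, hw']
    simp only [List.sum_append, List.sum_singleton]
    omega
  · intro y hy
    simp only [Finset.mem_sdiff, Finset.mem_Icc] at hy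
    omega

/-- The sequence `n ↦ s⋆(k∨, n + 1)`. -/
noncomputable def dualSeq (k : List ℕ) (n : ℕ) : ℝ := sStar (hdual k) (n + 1)

theorem F_eq_newtonSucc {k : List ℕ} (hk : k ≠ []) (z : ℂ) : F k z = newtonSucc (dualSeq k) z :=
  if_neg hk

theorem sum_pos_of_ne_nil {k : List ℕ} (hk : k ≠ []) (hpos : ∀ x ∈ k, 0 < x) : 0 < k.sum :=
  List.sum_pos k hpos hk

theorem dualSeq_one : dualSeq [1] = cesaro (Pi.single 0 1) := by
  ext n
  rw [dualSeq, hdual_one, sStar_singleton, cesaro, Finset.sum_pi_single']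
  simp

theorem dualSeq_append_one {k : List ℕ} (hk : k ≠ []) (hpos : ∀ x ∈ k, 0 < x) (n : ℕ) :
    dualSeq (k ++ [1]) n = dualSeq k n / (n + 1) := by
  obtain ⟨l, b, h1, h2⟩ := hdual_append_one hk (sum_pos_of_ne_nil hk hpos)
  rw [dualSeq, dualSeq, h1, h2, sStar_append_succ]

theorem dualSeq_append_add_two (k : List ℕ) (a : ℕ) :
    dualSeq (k ++ [a + 2]) = cesaro (dualSeq (k ++ [a + 1])) := by
  have hne : hdual (k ++ [a + 1]) ≠ [] := by
    rw [hdual_eq (by simp)]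
    simp
  ext n
  rw [dualSeq, hdual_append_add_two, sStar_append_singleton hne, sum_Icc_one_eq_sum_range, cesaro]
  simp [dualSeq]

theorem dualSeq_almostInv_and_completelyMonotone {k : List ℕ} (hk : k ≠ [])
    (hpos : ∀ x ∈ k, 0 < x) : AlmostInv (dualSeq k) ∧ CompletelyMonotone (dualSeq k) := by
  induction k using List.reverseRecOn with
  | nil => exact absurd rfl hk
  | append_singleton k a ih =>
    have hpos' : ∀ x ∈ k, 0 < x := fun x hx => hpos x (by simp [hx])
    obtain ⟨b, rfl⟩ : ∃ b, a = b + 1 := Nat.exists_eq_succ_of_ne_zero (hpos a (by simp)).ne'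
    clear hpos hk
    induction b with
    | zero =>
      rcases eq_or_ne k [] with rfl | hk
      · rw [List.nil_append, zero_add, dualSeq_one]
        exact ⟨almostInv_single.cesaro, completelyMonotone_single.cesaro⟩
      · obtain ⟨h1, h2⟩ := ih hk hpos'
        refine ⟨h1.mono fun n => ?_, h2.of_div (dualSeq_append_one hk hpos')⟩
        have h0 : (1 : ℝ) ≤ (n : ℝ) + 1 := by linarith [Nat.cast_nonneg (α := ℝ) n]
        rw [zero_add, dualSeq_append_one hk hpos', abs_div, abs_of_pos (by linarith : (0:ℝ) < n + 1)]
        exact div_le_self (abs_nonneg _) h0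
    | succ b ihb =>
      rw [dualSeq_append_add_two]
      exact ⟨ihb.1.cesaro, ihb.2.cesaro⟩

/-- The difference equation `F_k(z + 1) - F_k(z) = F_{k₋}(z + 1) / (z + 1) ^ k_r`. -/
theorem newton_dualSeq_append {k : List ℕ} (hpos : ∀ x ∈ k, 0 < x) (b : ℕ) {z : ℂ}
    (hz : -1 < z.re) :
    newton (dualSeq (k ++ [b + 1])) z = F k (z + 1) / (z + 1) ^ (b + 1) := by
  induction b with
  | zero =>
    rw [zero_add, pow_one]
    rcases eq_or_ne k [] with rfl | hk
    · rw [List.nil_append, dualSeq_one, newton_cesaro almostInv_single hz,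
        newton_eq_sub almostInv_single hz]
      simp [newtonSucc, F]
    · rw [newton_of_div (dualSeq_append_one hk hpos) hz, F_eq_newtonSucc hk]
  | succ b ih =>
    have hpos' : ∀ x ∈ k ++ [b + 1], 0 < x := by
      intro x hx
      rcases List.mem_append.1 hx with hx | hx
      · exact hpos x hx
      · simp [List.mem_singleton.1 hx]
    rw [dualSeq_append_add_two, newton_cesaro
      (dualSeq_almostInv_and_completelyMonotone (by simp) hpos').1 hz, ih, div_div, ← pow_succ]

theorem newtonSucc_natCast {u : ℕ → ℝ} (hu : AlmostInv u) (hc : CompletelyMonotone u) (n : ℕ) :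
    newtonSucc u n = (∑ i ∈ Finset.range n, bdiff^[i] u 0 : ℝ) := by
  induction n with
  | zero => simp [newtonSucc_zero]
  | succ n ih =>
    have h := newton_add_natCast hu hc (z := 0) (by simp) n
    rw [zero_add, newton_zero] at h
    have hn : -1 < (n : ℂ).re := by
      rw [Complex.natCast_re]
      linarith [Nat.cast_nonneg (α := ℝ) n]
    rw [Finset.sum_range_succ, Nat.cast_succ, newtonSucc_add_one hu hn, ih, h]
    push_cast
    rfl

/-- Hoffman's duality `(-Δ)ⁿ s⋆(k∨, ·)(1) = s⋆(k, n + 1)`. -/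
theorem bdiff_iterate_dualSeq_zero {k : List ℕ} (hk : k ≠ []) (hpos : ∀ x ∈ k, 0 < x) (n : ℕ) :
    bdiff^[n] (dualSeq k) 0 = sStar k (n + 1) := by
  induction k using List.reverseRecOn generalizing n with
  | nil => exact absurd rfl hk
  | append_singleton k a ih =>
    obtain ⟨hu, hc⟩ := dualSeq_almostInv_and_completelyMonotone hk hpos
    have hpos' : ∀ x ∈ k, 0 < x := fun x hx => hpos x (by simp [hx])
    obtain ⟨b, rfl⟩ : ∃ b, a = b + 1 := Nat.exists_eq_succ_of_ne_zero (hpos a (by simp)).ne'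
    have hn : -1 < (n : ℂ).re := by
      rw [Complex.natCast_re]
      linarith [Nat.cast_nonneg (α := ℝ) n]
    have h := newton_add_natCast hu hc (z := 0) (by simp) n
    rw [zero_add, newton_zero, newton_dualSeq_append hpos' b hn] at h
    refine Complex.ofReal_injective (h.symm.trans ?_)
    rcases eq_or_ne k [] with rfl | hk'
    · rw [List.nil_append, sStar_singleton]
      simp [F]
    · obtain ⟨hu', hc'⟩ := dualSeq_almostInv_and_completelyMonotone hk' hpos'
      rw [F_eq_newtonSucc hk', ← Nat.cast_succ, newtonSucc_natCast hu' hc',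
        sStar_append_singleton hk', sum_Icc_one_eq_sum_range]
      simp_rw [ih hk' hpos']
      push_cast
      rfl

theorem almostInv_sStar {k : List ℕ} (hk : k ≠ []) (hpos : ∀ x ∈ k, 0 < x) :
    AlmostInv fun n => sStar k (n + 1) := by
  have aux : ∀ (a n : ℕ), 0 < a → ∀ x : ℝ, |x / ((n : ℝ) + 1) ^ a| ≤ |x / ((n : ℝ) + 1)| := by
    intro a n ha x
    have h0 : (1 : ℝ) ≤ (n : ℝ) + 1 := by linarith [Nat.cast_nonneg (α := ℝ) n]
    rw [abs_div, abs_div, abs_of_pos (by positivity : (0 : ℝ) < ((n : ℝ) + 1) ^ a),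
      abs_of_pos (by positivity : (0 : ℝ) < (n : ℝ) + 1)]
    exact div_le_div_of_nonneg_left (abs_nonneg x) (by positivity)
      (le_self_pow₀ h0 ha.ne')
  induction k using List.reverseRecOn with
  | nil => exact absurd rfl hk
  | append_singleton k a ih =>
    have hpos' : ∀ x ∈ k, 0 < x := fun x hx => hpos x (by simp [hx])
    have ha : 0 < a := hpos a (by simp)
    rcases eq_or_ne k [] with rfl | hk'
    · refine almostInv_single.cesaro.mono fun n => ?_
      rw [List.nil_append, sStar_singleton, cesaro, Finset.sum_pi_single']
      simpa using aux a n ha 1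
    · refine (ih hk' hpos').cesaro.mono fun n => ?_
      rw [sStar_append_singleton hk', sum_Icc_one_eq_sum_range, cesaro, Nat.cast_succ]
      exact aux a n ha _

/-- Inductive fraction series:
`F_k(z) = Σ_{n=1}^∞ ( s⋆(k,n) - F_{k₋}(n+z)/(n+z)^{k_r} )` for `Re(z) > -1`. -/
theorem F_fraction_inductive (k : List ℕ) (hk : k ≠ []) (hpos : ∀ x ∈ k, 0 < x)
    (z : ℂ) (hz : -1 < z.re) :
    F k z = ∑' n : ℕ,
      (((sStar k (n + 1) : ℝ) : ℂ) -
        F k.dropLast (((n : ℂ) + 1) + z) / (((n : ℂ) + 1) + z) ^ (k.getLast hk)) := by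
  obtain ⟨hu, hc⟩ := dualSeq_almostInv_and_completelyMonotone hk hpos
  have hdual := bdiff_iterate_dualSeq_zero hk hpos
  have h0 : Tendsto (fun N => bdiff^[N] (dualSeq k) 0) atTop (𝓝 0) := by
    simp_rw [hdual]
    exact (almostInv_sStar hk hpos).tendsto_zero
  rw [F_eq_newtonSucc hk, newtonSucc_eq_tsum hu hc h0 hz]
  refine tsum_congr fun n => ?_
  have hn : -1 < (z + n).re := by
    rw [Complex.add_re, Complex.natCast_re]
    linarith [Nat.cast_nonneg (α := ℝ) n]
  obtain ⟨b, hb⟩ : ∃ b, k.getLast hk = b + 1 :=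
    Nat.exists_eq_succ_of_ne_zero (hpos _ (List.getLast_mem hk)).ne'
  have h := newton_dualSeq_append (k := k.dropLast)
    (fun x hx => hpos x (List.mem_of_mem_dropLast hx)) b hn
  rw [← hb, List.dropLast_append_getLast hk] at h
  rw [hdual, h, show z + (n : ℂ) + 1 = n + 1 + z by ring]

end Kawashima
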